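/- Let X be a real n×p matrix and let R be a real n×m matrix each of whose rows has unit Euclidean norm, such that Z⋆ = R Rᵀ maximizes trace(X Xᵀ Z) over all real symmetric positive-semidefinite n×n matrices Z with unit diagonal. Set α⋆² = trace(R Rᵀ X Xᵀ). Then (i) α⋆² ≥ ‖X Xᵀ‖_{∞→1}, and (ii) if g is a standard Gaussian random vector in ℝ^m and y = sign(R g) is the vector of signs of the entries of R g, then E‖Xᵀ y‖₂² ≥ (2/π) α⋆². -/

import Mathlib

open Matrix MeasureTheory
open scoped BigOperators

/-- The ℓ1 norm of a vector: sum of absolute values of the entries. -/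
def l1norm {n : ℕ} (v : Fin n → ℝ) : ℝ := ∑ i, |v i|

/-- The Euclidean (ℓ2) norm of a vector. -/
noncomputable def l2norm {p : ℕ} (u : Fin p → ℝ) : ℝ := Real.sqrt (∑ j, u j ^ 2)

/-- The ℓ∞ → ℓ1 operator norm of a matrix. -/
noncomputable def normInfto1 {n m : ℕ} (A : Matrix (Fin n) (Fin m) ℝ) : ℝ :=
  sSup {t : ℝ | ∃ u : Fin m → ℝ, (∀ j, |u j| ≤ 1) ∧ t = l1norm (A.mulVec u)}

/-- The sign of a real number: `1` if `0 ≤ t` and `-1` otherwise. -/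
noncomputable def sgn (t : ℝ) : ℝ := if 0 ≤ t then 1 else -1

/-- The law of a standard Gaussian random vector in ℝ^m: independent standard
normal coordinates. -/
noncomputable def stdGaussian (m : ℕ) : Measure (Fin m → ℝ) :=
  Measure.pi fun _ : Fin m => ProbabilityTheory.gaussianReal 0 1

open scoped ProbabilityTheory

lemma measurable_sgn : Measurable sgn :=
  Measurable.ite measurableSet_Ici measurable_const measurable_const

lemma sgn_mul_self (t : ℝ) : sgn t * t = |t| := by
  unfold sgn
  split_ifs with h
  · rw [one_mul, abs_of_nonneg h]
  · rw [abs_of_neg (not_le.mp h), neg_one_mul]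

lemma abs_sgn (t : ℝ) : |sgn t| = 1 := by
  unfold sgn
  split_ifs <;> simp

lemma trace_mul_vecMulVec_self {n : ℕ} (A : Matrix (Fin n) (Fin n) ℝ) (u : Fin n → ℝ) :
    (A * vecMulVec u u).trace = u ⬝ᵥ A *ᵥ u := by
  rw [mul_vecMulVec, trace_vecMulVec, dotProduct_comm]

/-- Filling up the diagonal of `u uᵀ` shows that the quadratic form on the cube is at most the
value of the semidefinite relaxation. -/
lemma dotProduct_mulVec_le_of_abs_le_one {n : ℕ} {A : Matrix (Fin n) (Fin n) ℝ}
    (hA : ∀ i, 0 ≤ A i i) {s : ℝ}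
    (hs : ∀ Z : Matrix (Fin n) (Fin n) ℝ, Z.PosSemidef → (∀ i, Z i i = 1) → (A * Z).trace ≤ s)
    {u : Fin n → ℝ} (hu : ∀ i, |u i| ≤ 1) : u ⬝ᵥ A *ᵥ u ≤ s := by
  have hd : ∀ i, 0 ≤ 1 - u i ^ 2 := fun i => sub_nonneg.2 ((sq_le_one_iff_abs_le_one _).2 (hu i))
  have hpsd : (vecMulVec u u + diagonal fun i => 1 - u i ^ 2).PosSemidef := by
    refine PosSemidef.add ?_ (PosSemidef.diagonal hd)
    simpa using posSemidef_vecMulVec_self_star u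
  have h := hs _ hpsd fun i => by simp [vecMulVec_apply, sq]
  rw [Matrix.mul_add, trace_add, trace_mul_vecMulVec_self] at h
  have : 0 ≤ (A * diagonal fun i => 1 - u i ^ 2).trace := by
    simp only [trace, diag_apply, mul_diagonal]
    exact Finset.sum_nonneg fun i _ => mul_nonneg (hA i) (hd i)
  linarith

lemma l1norm_mulVec_le {n p : ℕ} (X : Matrix (Fin n) (Fin p) ℝ) {s : ℝ}
    (hs : ∀ Z : Matrix (Fin n) (Fin n) ℝ, Z.PosSemidef → (∀ i, Z i i = 1) →
      (X * Xᵀ * Z).trace ≤ s)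
    {u : Fin n → ℝ} (hu : ∀ i, |u i| ≤ 1) : l1norm ((X * Xᵀ) *ᵥ u) ≤ s := by
  have hquad : ∀ a b : Fin n → ℝ, a ⬝ᵥ (X * Xᵀ) *ᵥ b = (Xᵀ *ᵥ a) ⬝ᵥ (Xᵀ *ᵥ b) := fun a b => by
    rw [← mulVec_mulVec, dotProduct_mulVec, mulVec_transpose X a]
  have hdiag : ∀ i, 0 ≤ (X * Xᵀ) i i := fun i => by
    simp only [mul_apply, transpose_apply]
    exact Finset.sum_nonneg fun j _ => mul_self_nonneg _
  set v : Fin n → ℝ := fun i => sgn (((X * Xᵀ) *ᵥ u) i) with hv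
  have h1 : l1norm ((X * Xᵀ) *ᵥ u) = v ⬝ᵥ (X * Xᵀ) *ᵥ u := by
    simp only [l1norm, dotProduct, hv, sgn_mul_self]
  have h2 := dotProduct_mulVec_le_of_abs_le_one hdiag hs hu
  have h3 := dotProduct_mulVec_le_of_abs_le_one hdiag hs (u := v) fun i => (abs_sgn _).le
  rw [hquad] at h1 h2 h3
  have h4 : 0 ≤ (Xᵀ *ᵥ v - Xᵀ *ᵥ u) ⬝ᵥ (Xᵀ *ᵥ v - Xᵀ *ᵥ u) := by
    simpa using dotProduct_star_self_nonneg (Xᵀ *ᵥ v - Xᵀ *ᵥ u)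
  simp only [sub_dotProduct, dotProduct_sub] at h4
  have h5 := dotProduct_comm (Xᵀ *ᵥ v) (Xᵀ *ᵥ u)
  linarith

lemma integral_abs_gaussianReal :
    ∫ x, |x| ∂(ProbabilityTheory.gaussianReal 0 1) = Real.sqrt (2 / Real.pi) := by
  rw [ProbabilityTheory.integral_gaussianReal_eq_integral_smul one_ne_zero]
  set f : ℝ → ℝ := fun t =>
    (Real.sqrt (2 * Real.pi))⁻¹ * (t ^ (1 : ℝ) * Real.exp (-(1 / 2) * t ^ (2 : ℝ))) with hf
  have h : ∀ x : ℝ, ProbabilityTheory.gaussianPDFReal 0 1 x • |x| = f |x| := fun x => by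
    simp only [hf, ProbabilityTheory.gaussianPDFReal, smul_eq_mul, Real.rpow_one, Real.rpow_two,
      sq_abs, sub_zero, NNReal.coe_one, mul_one]
    rw [show -x ^ 2 / 2 = -(1 / 2) * x ^ 2 by ring]
    ring
  simp_rw [h]
  rw [integral_comp_abs (f := f), hf, integral_const_mul,
    integral_rpow_mul_exp_neg_mul_rpow two_pos (by norm_num) (by norm_num)]
  norm_num
  have hpi := Real.pi_pos
  have : Real.sqrt 2 ≠ 0 := by positivity
  field_simp
  norm_num

section

variable {m : ℕ}

instance : IsProbabilityMeasure (stdGaussian m) := by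
  unfold stdGaussian
  infer_instance

lemma hasGaussianLaw_id_stdGaussian :
    ProbabilityTheory.HasGaussianLaw (fun g : Fin m → ℝ => (fun i => g i)) (stdGaussian m) := by
  refine ProbabilityTheory.iIndepFun.hasGaussianLaw (X := fun i (g : Fin m → ℝ) => g i)
    (fun i => ⟨?_⟩) ?_
  · rw [stdGaussian, (measurePreserving_eval _ i).map_eq]
    infer_instance
  · exact ProbabilityTheory.iIndepFun_pi (X := fun _ => id) fun _ => aemeasurable_id

/-- The linear functional `g ↦ w ⬝ᵥ g`. -/
noncomputable def dotCLM (w : Fin m → ℝ) : (Fin m → ℝ) →L[ℝ] ℝ :=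
  ∑ i, w i • ContinuousLinearMap.proj i

lemma dotCLM_apply (w g : Fin m → ℝ) : dotCLM w g = w ⬝ᵥ g := by
  simp [dotCLM, dotProduct]

lemma hasGaussianLaw_dotProduct (w : Fin m → ℝ) :
    ProbabilityTheory.HasGaussianLaw (fun g => w ⬝ᵥ g) (stdGaussian m) := by
  simpa only [dotCLM_apply] using hasGaussianLaw_id_stdGaussian.map_fun (dotCLM w)

lemma hasGaussianLaw_dotProduct_prodMk (v w : Fin m → ℝ) :
    ProbabilityTheory.HasGaussianLaw (fun g => (v ⬝ᵥ g, w ⬝ᵥ g)) (stdGaussian m) := by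
  simpa only [dotCLM_apply, ContinuousLinearMap.prod_apply] using
    hasGaussianLaw_id_stdGaussian.map_fun ((dotCLM v).prod (dotCLM w))

lemma integral_dotProduct (w : Fin m → ℝ) : ∫ g, w ⬝ᵥ g ∂(stdGaussian m) = 0 := by
  have h : ∫ g : Fin m → ℝ, g ∂(stdGaussian m) = 0 := by
    funext i
    rw [← ContinuousLinearMap.proj_apply (R := ℝ) (φ := fun _ : Fin m => ℝ) i (∫ g, g ∂_),
      ← ContinuousLinearMap.integral_comp_comm _ hasGaussianLaw_id_stdGaussian.integrable]
    have := integral_comp_eval (μ := fun _ : Fin m => ProbabilityTheory.gaussianReal 0 1) (i := i)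
      (f := id) aestronglyMeasurable_id
    simpa [stdGaussian] using this
  simp_rw [← dotCLM_apply]
  rw [ContinuousLinearMap.integral_comp_comm _ hasGaussianLaw_id_stdGaussian.integrable, h, map_zero]

lemma variance_dotProduct (w : Fin m → ℝ) :
    Var[fun g => w ⬝ᵥ g; stdGaussian m] = w ⬝ᵥ w := by
  have : (fun g : Fin m → ℝ => w ⬝ᵥ g) = ∑ i, fun g : Fin m → ℝ => w i * g i := by
    ext g
    simp [dotProduct]
  rw [this, stdGaussian, ProbabilityTheory.variance_sum_pi (X := fun i x => w i * x)]
  · change ∑ i, Var[fun x => w i * id x; ProbabilityTheory.gaussianReal 0 1] = _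
    simp_rw [ProbabilityTheory.variance_const_mul, ProbabilityTheory.variance_id_gaussianReal]
    simp [dotProduct, sq]
  · exact fun i => ProbabilityTheory.IsGaussian.memLp_two_id.const_mul _

lemma integral_dotProduct_sq (w : Fin m → ℝ) :
    ∫ g, (w ⬝ᵥ g) ^ 2 ∂(stdGaussian m) = w ⬝ᵥ w := by
  rw [← variance_dotProduct, ProbabilityTheory.variance_of_integral_eq_zero
    (hasGaussianLaw_dotProduct w).aemeasurable (integral_dotProduct w)]

lemma covariance_dotProduct_eq_zero {v w : Fin m → ℝ} (h : v ⬝ᵥ w = 0) :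
    cov[fun g => v ⬝ᵥ g, fun g => w ⬝ᵥ g; stdGaussian m] = 0 := by
  have := ProbabilityTheory.variance_fun_add (hasGaussianLaw_dotProduct v).memLp_two
    (hasGaussianLaw_dotProduct w).memLp_two
  simp_rw [← add_dotProduct, variance_dotProduct, add_dotProduct, dotProduct_add,
    dotProduct_comm w v, h] at this
  linarith

lemma measurable_sgn_dotProduct (v : Fin m → ℝ) : Measurable fun g => sgn (v ⬝ᵥ g) := by
  simp_rw [← dotCLM_apply]
  exact measurable_sgn.comp (dotCLM v).measurable

lemma integrable_sgn_mul_dotProduct (v w : Fin m → ℝ) :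
    Integrable (fun g => sgn (v ⬝ᵥ g) * (w ⬝ᵥ g)) (stdGaussian m) :=
  (hasGaussianLaw_dotProduct w).integrable.bdd_mul (c := 1)
    (measurable_sgn_dotProduct v).aestronglyMeasurable
    (Filter.Eventually.of_forall fun _ => (abs_sgn _).le)

lemma integral_sgn_mul_dotProduct_of_orthogonal {v w : Fin m → ℝ} (h : v ⬝ᵥ w = 0) :
    ∫ g, sgn (v ⬝ᵥ g) * (w ⬝ᵥ g) ∂(stdGaussian m) = 0 := by
  have hind := ((hasGaussianLaw_dotProduct_prodMk v w).indepFun_of_covariance_eq_zero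
    (covariance_dotProduct_eq_zero h)).comp measurable_sgn measurable_id
  have := hind.integral_mul_eq_mul_integral
    (measurable_sgn_dotProduct v).aestronglyMeasurable
    (hasGaussianLaw_dotProduct w).aemeasurable.aestronglyMeasurable
  simpa [integral_dotProduct] using this

lemma integral_abs_dotProduct {r : Fin m → ℝ} (hr : r ⬝ᵥ r = 1) :
    ∫ g, |r ⬝ᵥ g| ∂(stdGaussian m) = Real.sqrt (2 / Real.pi) := by
  have h := hasGaussianLaw_dotProduct r
  have hmap := h.map_eq_gaussianReal
  rw [integral_dotProduct, variance_dotProduct, hr, Real.toNNReal_one] at hmap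
  rw [← integral_abs_gaussianReal, ← hmap, integral_map h.aemeasurable (by fun_prop)]

lemma integral_sgn_mul_dotProduct {r : Fin m → ℝ} (hr : r ⬝ᵥ r = 1) (w : Fin m → ℝ) :
    ∫ g, sgn (r ⬝ᵥ g) * (w ⬝ᵥ g) ∂(stdGaussian m) = Real.sqrt (2 / Real.pi) * (r ⬝ᵥ w) := by
  have horth : r ⬝ᵥ (w - (r ⬝ᵥ w) • r) = 0 := by
    simp [dotProduct_sub, hr]
  have hsplit : ∀ g : Fin m → ℝ, sgn (r ⬝ᵥ g) * (w ⬝ᵥ g)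
      = (r ⬝ᵥ w) * (sgn (r ⬝ᵥ g) * (r ⬝ᵥ g)) + sgn (r ⬝ᵥ g) * ((w - (r ⬝ᵥ w) • r) ⬝ᵥ g) := by
    intro g
    simp only [sub_dotProduct, smul_dotProduct, smul_eq_mul]
    ring
  simp_rw [hsplit]
  rw [integral_add ((integrable_sgn_mul_dotProduct r r).const_mul _)
    (integrable_sgn_mul_dotProduct r _), integral_const_mul,
    integral_sgn_mul_dotProduct_of_orthogonal horth]
  simp_rw [sgn_mul_self]
  rw [integral_abs_dotProduct hr, add_zero, mul_comm]

lemma integrable_dotProduct_sgn_sq {n : ℕ} (R : Matrix (Fin n) (Fin m) ℝ) (x : Fin n → ℝ) :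
    Integrable (fun g => (x ⬝ᵥ fun i => sgn ((R *ᵥ g) i)) ^ 2) (stdGaussian m) := by
  have hmeas : Measurable fun g : Fin m → ℝ => (x ⬝ᵥ fun i => sgn ((R *ᵥ g) i)) ^ 2 := by
    refine Measurable.pow_const (Finset.measurable_sum _ fun i _ => ?_) 2
    exact (measurable_sgn_dotProduct (R i)).const_mul _
  refine Integrable.of_bound hmeas.aestronglyMeasurable ((∑ i, |x i|) ^ 2)
    (Filter.Eventually.of_forall fun g => ?_)
  rw [Real.norm_eq_abs, abs_pow]
  gcongr
  refine (Finset.abs_sum_le_sum_abs _ _).trans_eq (Finset.sum_congr rfl fun i _ => ?_)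
  rw [abs_mul, abs_sgn, mul_one]

/-- Rietz's inequality: `E[y yᵀ] ≥ (2/π) R Rᵀ` as quadratic forms, for `y = sign (R g)`. -/
lemma two_div_pi_mul_le_integral_dotProduct_sgn_sq {n : ℕ} {R : Matrix (Fin n) (Fin m) ℝ}
    (hR : ∀ i, R i ⬝ᵥ R i = 1) (x : Fin n → ℝ) :
    2 / Real.pi * ((x ᵥ* R) ⬝ᵥ (x ᵥ* R)) ≤
      ∫ g, (x ⬝ᵥ fun i => sgn ((R *ᵥ g) i)) ^ 2 ∂(stdGaussian m) := by
  set w := x ᵥ* R with hw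
  set c := Real.sqrt (2 / Real.pi) with hc
  have hcc : c * c = 2 / Real.pi := Real.mul_self_sqrt (by positivity)
  have hexp : ∀ g : Fin m → ℝ, (x ⬝ᵥ fun i => sgn ((R *ᵥ g) i)) * (w ⬝ᵥ g)
      = ∑ i, x i * (sgn (R i ⬝ᵥ g) * (w ⬝ᵥ g)) := fun g => by
    rw [dotProduct, Finset.sum_mul]
    exact Finset.sum_congr rfl fun i _ => mul_assoc _ _ _
  have hint : ∀ i ∈ Finset.univ,
      Integrable (fun g => x i * (sgn (R i ⬝ᵥ g) * (w ⬝ᵥ g))) (stdGaussian m) :=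
    fun i _ => (integrable_sgn_mul_dotProduct _ _).const_mul _
  have hcross : ∫ g, (x ⬝ᵥ fun i => sgn ((R *ᵥ g) i)) * (w ⬝ᵥ g) ∂(stdGaussian m)
      = c * (w ⬝ᵥ w) := by
    simp_rw [hexp]
    rw [integral_finsetSum _ hint]
    simp_rw [integral_const_mul, integral_sgn_mul_dotProduct (hR _)]
    rw [show w ⬝ᵥ w = x ⬝ᵥ R *ᵥ w by rw [dotProduct_mulVec], dotProduct, Finset.mul_sum]
    exact Finset.sum_congr rfl fun i _ => mul_left_comm _ _ _
  have hcross_int : Integrable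
      (fun g => (x ⬝ᵥ fun i => sgn ((R *ᵥ g) i)) * (w ⬝ᵥ g)) (stdGaussian m) := by
    simp_rw [hexp]
    exact integrable_finsetSum _ hint
  have hsq_int := (hasGaussianLaw_dotProduct w).memLp_two.integrable_sq
  have hmono := integral_mono ((hcross_int.const_mul (2 * c)).sub (hsq_int.const_mul (c ^ 2)))
    (integrable_dotProduct_sgn_sq R x) fun g => by
      have := sq_nonneg ((x ⬝ᵥ fun i => sgn ((R *ᵥ g) i)) - c * (w ⬝ᵥ g))
      simp only [Pi.sub_apply]
      linarith
  simp only [Pi.sub_apply] at hmono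
  rw [integral_sub (hcross_int.const_mul _) (hsq_int.const_mul _), integral_const_mul,
    integral_const_mul, hcross, integral_dotProduct_sq] at hmono
  rw [← hcc]
  linarith

end

theorem sdp_rounding_expectation {n p m : ℕ} (X : Matrix (Fin n) (Fin p) ℝ)
    (R : Matrix (Fin n) (Fin m) ℝ)
    (hrows : ∀ i, ∑ j, R i j ^ 2 = 1)
    (hmax : ∀ Z : Matrix (Fin n) (Fin n) ℝ, Z.PosSemidef → (∀ i, Z i i = 1) →
      (X * Xᵀ * Z).trace ≤ (X * Xᵀ * (R * Rᵀ)).trace)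
    (αsq : ℝ) (hα : αsq = (R * Rᵀ * (X * Xᵀ)).trace) :
    normInfto1 (X * Xᵀ) ≤ αsq ∧
      2 / Real.pi * αsq ≤
        ∫ g, l2norm (Xᵀ.mulVec fun i => sgn (R.mulVec g i)) ^ 2 ∂(stdGaussian m) := by
  have hα' : αsq = (X * Xᵀ * (R * Rᵀ)).trace := by rw [hα, trace_mul_comm]
  refine ⟨csSup_le ⟨_, 0, by simp, rfl⟩ ?_, ?_⟩
  · rintro _ ⟨u, hu, rfl⟩
    exact l1norm_mulVec_le X (hα' ▸ hmax) hu
  · have hnorm : ∀ g, l2norm (Xᵀ.mulVec fun i => sgn (R.mulVec g i)) ^ 2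
        = ∑ k, (X.col k ⬝ᵥ fun i => sgn ((R *ᵥ g) i)) ^ 2 := fun g =>
      Real.sq_sqrt (Finset.sum_nonneg fun _ _ => sq_nonneg _)
    have hR : ∀ i, R i ⬝ᵥ R i = 1 := fun i => by
      rw [← hrows i, dotProduct]
      exact Finset.sum_congr rfl fun _ _ => (sq _).symm
    have hsum : αsq = ∑ k, (X.col k ᵥ* R) ⬝ᵥ (X.col k ᵥ* R) := by
      rw [hα', Matrix.mul_assoc, trace_mul_comm,
        show Xᵀ * (R * Rᵀ) * X = (Xᵀ * R) * (Xᵀ * R)ᵀ by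
          rw [transpose_mul, transpose_transpose]
          simp only [Matrix.mul_assoc]]
      rfl
    simp_rw [hnorm]
    rw [integral_finsetSum _ fun k _ => integrable_dotProduct_sgn_sq R (X.col k), hsum,
      Finset.mul_sum]
    exact Finset.sum_le_sum fun k _ => two_div_pi_mul_le_integral_dotProduct_sgn_sq hR _
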